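/- There exist a constant c ≥ 1 and an exponent θ ∈ (0,2) such that for every continuous function f ∈ C(F) and all x, y ∈ F: |f(x) − f(y)|² ≤ c·|x − y|^θ·sup_{n≥0} 𝓡_n·D_n(f|_{V_n}), where |x − y| is the Euclidean distance (the inequality is trivially true when the supremum is infinite). In particular every f ∈ C(F) with sup_{n≥0} 𝓡_n·D_n(f|_{V_n}) < ∞ is (θ/2)-Hölder continuous on F. (Hölder continuity of functions of finite energy; Remark 4.4(1) of the paper in the planar case.) -/

import Mathlib

open Finset
open scoped Classical

namespace Carpet

/-- The contraction map `Ψ_{(a,b)}(x,y) = ((x+a)/L, (y+b)/L)`. -/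
noncomputable def Psi (L : ℕ) (p : ℕ × ℕ) (x : ℝ × ℝ) : ℝ × ℝ :=
  ((x.1 + p.1) / L, (x.2 + p.2) / L)

/-- Words of length `n` over the alphabet `A`. -/
abbrev Word (A : Finset (ℕ × ℕ)) (n : ℕ) := Fin n → {p : ℕ × ℕ // p ∈ A}

/-- `Ψ_w = Ψ_{w₁} ∘ ⋯ ∘ Ψ_{w_n}`. -/
noncomputable def PsiW (L : ℕ) {A : Finset (ℕ × ℕ)} {n : ℕ} (w : Word A n) : ℝ × ℝ → ℝ × ℝ :=
  (List.ofFn fun i => Psi L (w i).1).foldr (· ∘ ·) id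

/-- The four corners of the unit square. -/
noncomputable def V0 : Finset (ℝ × ℝ) :=
  {((0 : ℝ), (0 : ℝ)), ((1 : ℝ), (0 : ℝ)), ((1 : ℝ), (1 : ℝ)), ((0 : ℝ), (1 : ℝ))}

/-- The level-`n` vertex set `V_n = ⋃_{w ∈ W_n} Ψ_w(V₀)`. -/
noncomputable def VN (L : ℕ) (A : Finset (ℕ × ℕ)) (n : ℕ) : Finset (ℝ × ℝ) :=
  (Finset.univ : Finset (Word A n)).biUnion fun w => V0.image (PsiW L w)

/-- Euclidean distance in the plane. -/
noncomputable def eudist (x y : ℝ × ℝ) : ℝ :=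
  Real.sqrt ((x.1 - y.1) ^ 2 + (x.2 - y.2) ^ 2)

/-- `n`-adjacency: `x = Ψ_w(p)`, `y = Ψ_w(q)` with `p, q ∈ V₀`, `|p - q| = 1`. -/
def Adj (L : ℕ) (A : Finset (ℕ × ℕ)) (n : ℕ) (x y : ℝ × ℝ) : Prop :=
  ∃ w : Word A n, ∃ p ∈ V0, ∃ q ∈ V0,
    eudist p q = 1 ∧ x = PsiW L w p ∧ y = PsiW L w q

/-- The natural graph energy `D_n(f) = Σ_{x ∼ y} (f x - f y)²`
(summing over ordered pairs and halving). -/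
noncomputable def Dform (L : ℕ) (A : Finset (ℕ × ℕ)) (n : ℕ) (f : ℝ × ℝ → ℝ) : ℝ :=
  (1 / 2) * ∑ x ∈ VN L A n, ∑ y ∈ VN L A n,
    (if Adj L A n x y then (f x - f y) ^ 2 else 0)

/-- The effective resistance between `S` and `T` in the level-`n` graph. -/
noncomputable def EffRes (L : ℕ) (A : Finset (ℕ × ℕ)) (n : ℕ) (S T : Set (ℝ × ℝ)) : ℝ :=
  (sInf {e : ℝ | ∃ f : ℝ × ℝ → ℝ,
      (∀ x ∈ S, f x = 1) ∧ (∀ x ∈ T, f x = 0) ∧ e = Dform L A n f})⁻¹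

/-- `𝓡_n`, the resistance between the corners `(0,0)` and `(1,0)`. -/
noncomputable def RR (L : ℕ) (A : Finset (ℕ × ℕ)) (n : ℕ) : ℝ :=
  EffRes L A n {((0 : ℝ), (0 : ℝ))} {((1 : ℝ), (0 : ℝ))}

/-- `𝓡̄_n`, the resistance between the left and right sides of the unit square. -/
noncomputable def RRbar (L : ℕ) (A : Finset (ℕ × ℕ)) (n : ℕ) : ℝ :=
  EffRes L A n
    ((VN L A n : Set (ℝ × ℝ)) ∩ ({(0 : ℝ)} ×ˢ Set.Icc (0 : ℝ) 1))
    ((VN L A n : Set (ℝ × ℝ)) ∩ ({(1 : ℝ)} ×ˢ Set.Icc (0 : ℝ) 1))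

/-- The standing assumptions on `(L, A)` defining a generalized Sierpiński carpet. -/
structure GoodCarpet (L : ℕ) (A : Finset (ℕ × ℕ)) : Prop where
  three_le : 3 ≤ L
  mem_lt : ∀ p ∈ A, p.1 < L ∧ p.2 < L
  symm_swap : ∀ a b : ℕ, (a, b) ∈ A → (b, a) ∈ A
  symm_reflect : ∀ a b : ℕ, (a, b) ∈ A → (L - 1 - a, b) ∈ A
  connected : IsConnected
    (⋃ p ∈ A, Set.Icc (((p.1 : ℝ) / L, (p.2 : ℝ) / L) : ℝ × ℝ)
      ((((p.1 : ℝ) + 1) / L, ((p.2 : ℝ) + 1) / L) : ℝ × ℝ))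
  flat_border : ∀ a b : ℕ, a < L → b < L →
    (a = 0 ∨ a = L - 1 ∨ b = 0 ∨ b = L - 1) → (a, b) ∈ A
  proper : ∃ a b : ℕ, a < L ∧ b < L ∧ (a, b) ∉ A

/-- The generalized Sierpiński carpet `F`. -/
def carpetF (L : ℕ) (A : Finset (ℕ × ℕ)) : Set (ℝ × ℝ) :=
  ⋂ n : ℕ, ⋃ w : Word A n, PsiW L w '' Set.Icc (((0 : ℝ), (0 : ℝ)) : ℝ × ℝ) ((1 : ℝ), (1 : ℝ))


/-! ### Cell maps and their recursive description -/

/-- `φ` is one of the level-`n` cell maps. -/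
def IsCell (L : ℕ) (A : Finset (ℕ × ℕ)) (n : ℕ) (φ : ℝ × ℝ → ℝ × ℝ) : Prop :=
  ∃ w : Word A n, φ = PsiW L w

lemma isCell_zero {L : ℕ} {A : Finset (ℕ × ℕ)} {φ : ℝ × ℝ → ℝ × ℝ} :
    IsCell L A 0 φ ↔ φ = id := by
  constructor
  · rintro ⟨w, rfl⟩
    simp [PsiW]
  · rintro rfl
    exact ⟨fun i => i.elim0, by simp [PsiW]⟩

lemma isCell_succ {L : ℕ} {A : Finset (ℕ × ℕ)} {n : ℕ} {φ : ℝ × ℝ → ℝ × ℝ} :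
    IsCell L A (n + 1) φ ↔ ∃ a ∈ A, ∃ ψ, IsCell L A n ψ ∧ φ = Psi L a ∘ ψ := by
  constructor
  · rintro ⟨w, rfl⟩
    refine ⟨(w 0).1, (w 0).2, PsiW L (fun i : Fin n => w i.succ), ⟨_, rfl⟩, ?_⟩
    simp [PsiW, List.ofFn_succ]
  · rintro ⟨a, ha, ψ, ⟨w, rfl⟩, rfl⟩
    refine ⟨Fin.cons ⟨a, ha⟩ w, ?_⟩
    simp [PsiW, List.ofFn_succ]

lemma isCell_split {L : ℕ} {A : Finset (ℕ × ℕ)} {m n : ℕ} {φ : ℝ × ℝ → ℝ × ℝ}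
    (hφ : IsCell L A (m + n) φ) :
    ∃ ψ χ, IsCell L A m ψ ∧ IsCell L A n χ ∧ φ = ψ ∘ χ := by
  induction m generalizing φ with
  | zero => exact ⟨id, φ, isCell_zero.2 rfl, by simpa using hφ, rfl⟩
  | succ m ih =>
    rw [show m + 1 + n = (m + n) + 1 by ring, isCell_succ] at hφ
    obtain ⟨a, ha, ψ, hψ, rfl⟩ := hφ
    obtain ⟨ψ', χ, h1, h2, rfl⟩ := ih hψ
    exact ⟨Psi L a ∘ ψ', χ, isCell_succ.2 ⟨a, ha, ψ', h1, rfl⟩, h2, rfl⟩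

lemma isCell_form {L : ℕ} {A : Finset (ℕ × ℕ)} (hL : 3 ≤ L) {n : ℕ} {φ : ℝ × ℝ → ℝ × ℝ}
    (hφ : IsCell L A n φ) :
    ∃ i j : ℕ, ∀ x, φ x = ((x.1 + i) / (L : ℝ) ^ n, (x.2 + j) / (L : ℝ) ^ n) := by
  have hL0 : (L : ℝ) ≠ 0 := by positivity
  induction n generalizing φ with
  | zero =>
    rw [isCell_zero] at hφ
    subst hφ
    exact ⟨0, 0, fun x => by simp⟩
  | succ n ih =>
    obtain ⟨a, ha, ψ, hψ, rfl⟩ := isCell_succ.1 hφ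
    obtain ⟨i, j, hij⟩ := ih hψ
    refine ⟨i + a.1 * L ^ n, j + a.2 * L ^ n, fun x => ?_⟩
    simp only [Function.comp, hij, Psi]
    ext
    · push_cast; field_simp; ring
    · push_cast; field_simp; ring

lemma adj_iff {L : ℕ} {A : Finset (ℕ × ℕ)} {n : ℕ} {x y : ℝ × ℝ} :
    Adj L A n x y ↔ ∃ φ, IsCell L A n φ ∧ ∃ p ∈ V0, ∃ q ∈ V0,
      eudist p q = 1 ∧ x = φ p ∧ y = φ q := by
  constructor
  · rintro ⟨w, h⟩
    exact ⟨_, ⟨w, rfl⟩, h⟩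
  · rintro ⟨_, ⟨w, rfl⟩, h⟩
    exact ⟨w, h⟩

lemma adj_zero {L : ℕ} {A : Finset (ℕ × ℕ)} {x y : ℝ × ℝ} :
    Adj L A 0 x y ↔ x ∈ V0 ∧ y ∈ V0 ∧ eudist x y = 1 := by
  rw [adj_iff]
  constructor
  · rintro ⟨φ, hφ, p, hp, q, hq, h, rfl, rfl⟩
    rw [isCell_zero] at hφ
    subst hφ
    exact ⟨hp, hq, h⟩
  · rintro ⟨hx, hy, h⟩
    exact ⟨id, isCell_zero.2 rfl, x, hx, y, hy, h, rfl, rfl⟩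

lemma adj_succ {L : ℕ} {A : Finset (ℕ × ℕ)} {n : ℕ} {x y : ℝ × ℝ} :
    Adj L A (n + 1) x y ↔
      ∃ a ∈ A, ∃ x' y', Adj L A n x' y' ∧ x = Psi L a x' ∧ y = Psi L a y' := by
  rw [adj_iff]
  constructor
  · rintro ⟨φ, hφ, p, hp, q, hq, h, rfl, rfl⟩
    obtain ⟨a, ha, ψ, hψ, rfl⟩ := isCell_succ.1 hφ
    exact ⟨a, ha, ψ p, ψ q, adj_iff.2 ⟨ψ, hψ, p, hp, q, hq, h, rfl, rfl⟩, rfl, rfl⟩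
  · rintro ⟨a, ha, x', y', h', rfl, rfl⟩
    obtain ⟨ψ, hψ, p, hp, q, hq, h, rfl, rfl⟩ := adj_iff.1 h'
    exact ⟨_, isCell_succ.2 ⟨a, ha, ψ, hψ, rfl⟩, p, hp, q, hq, h, rfl, rfl⟩

lemma mem_VN {L : ℕ} {A : Finset (ℕ × ℕ)} {n : ℕ} {x : ℝ × ℝ} :
    x ∈ VN L A n ↔ ∃ φ, IsCell L A n φ ∧ ∃ p ∈ V0, x = φ p := by
  simp only [VN, Finset.mem_biUnion, Finset.mem_image, Finset.mem_univ, true_and]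
  constructor
  · rintro ⟨w, p, hp, rfl⟩
    exact ⟨_, ⟨w, rfl⟩, p, hp, rfl⟩
  · rintro ⟨_, ⟨w, rfl⟩, p, hp, rfl⟩
    exact ⟨w, p, hp, rfl⟩

lemma adj_mem {L : ℕ} {A : Finset (ℕ × ℕ)} {n : ℕ} {x y : ℝ × ℝ} (h : Adj L A n x y) :
    x ∈ VN L A n ∧ y ∈ VN L A n := by
  obtain ⟨φ, hφ, p, hp, q, hq, -, rfl, rfl⟩ := adj_iff.1 h
  exact ⟨mem_VN.2 ⟨φ, hφ, p, hp, rfl⟩, mem_VN.2 ⟨φ, hφ, q, hq, rfl⟩⟩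

lemma Psi_injective {L : ℕ} (hL : 3 ≤ L) (a : ℕ × ℕ) : Function.Injective (Psi L a) := by
  have hL0 : (L : ℝ) ≠ 0 := by positivity
  intro x y hxy
  simp only [Psi, Prod.mk.injEq] at hxy
  obtain ⟨h1, h2⟩ := hxy
  rw [div_left_inj' hL0] at h1 h2
  ext <;> linarith

/-! ### The energy -/

/-- The finite set of ordered adjacent pairs. -/
noncomputable def EN (L : ℕ) (A : Finset (ℕ × ℕ)) (n : ℕ) : Finset ((ℝ × ℝ) × (ℝ × ℝ)) :=
  (VN L A n ×ˢ VN L A n).filter fun z => Adj L A n z.1 z.2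

lemma mem_EN {L : ℕ} {A : Finset (ℕ × ℕ)} {n : ℕ} {z : (ℝ × ℝ) × (ℝ × ℝ)} :
    z ∈ EN L A n ↔ Adj L A n z.1 z.2 := by
  simp only [EN, Finset.mem_filter, Finset.mem_product, and_iff_right_iff_imp]
  exact adj_mem

lemma Dform_eq (L : ℕ) (A : Finset (ℕ × ℕ)) (n : ℕ) (f : ℝ × ℝ → ℝ) :
    Dform L A n f = (1 / 2) * ∑ z ∈ EN L A n, (f z.1 - f z.2) ^ 2 := by
  rw [Dform, EN, Finset.sum_filter, Finset.sum_product]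

lemma Dform_nonneg (L : ℕ) (A : Finset (ℕ × ℕ)) (n : ℕ) (f : ℝ × ℝ → ℝ) :
    0 ≤ Dform L A n f := by
  rw [Dform_eq]
  have := Finset.sum_nonneg (s := EN L A n) (f := fun z => (f z.1 - f z.2) ^ 2)
    (fun z _ => sq_nonneg _)
  linarith

lemma Dform_comp_le {L : ℕ} {A : Finset (ℕ × ℕ)} {n m : ℕ} {φ : ℝ × ℝ → ℝ × ℝ}
    (hinj : Function.Injective φ)
    (hφ : ∀ x y, Adj L A n x y → Adj L A m (φ x) (φ y)) (g : ℝ × ℝ → ℝ) :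
    Dform L A n (g ∘ φ) ≤ Dform L A m g := by
  rw [Dform_eq, Dform_eq]
  have h1 : ∑ z ∈ (EN L A n).image (Prod.map φ φ), (g z.1 - g z.2) ^ 2
      = ∑ z ∈ EN L A n, ((g ∘ φ) z.1 - (g ∘ φ) z.2) ^ 2 := by
    rw [Finset.sum_image]
    · rfl
    · exact (hinj.prodMap hinj).injOn
  have h2 : ∑ z ∈ (EN L A n).image (Prod.map φ φ), (g z.1 - g z.2) ^ 2
      ≤ ∑ z ∈ EN L A m, (g z.1 - g z.2) ^ 2 := by
    apply Finset.sum_le_sum_of_subset_of_nonneg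
    · intro z hz
      obtain ⟨y, hy, rfl⟩ := Finset.mem_image.1 hz
      exact mem_EN.2 (hφ _ _ (mem_EN.1 hy))
    · intro z _ _
      exact sq_nonneg _
  rw [← h1]
  linarith

lemma Dform_Psi_le {L : ℕ} {A : Finset (ℕ × ℕ)} (hL : 3 ≤ L) {n : ℕ} {a : ℕ × ℕ} (ha : a ∈ A)
    (g : ℝ × ℝ → ℝ) : Dform L A n (g ∘ Psi L a) ≤ Dform L A (n + 1) g :=
  Dform_comp_le (Psi_injective hL a)
    (fun x y hxy => adj_succ.2 ⟨a, ha, x, y, hxy, rfl, rfl⟩) g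

lemma Dform_cell_le {L : ℕ} {A : Finset (ℕ × ℕ)} (hL : 3 ≤ L) {n m : ℕ} {φ : ℝ × ℝ → ℝ × ℝ}
    (hφ : IsCell L A m φ) (g : ℝ × ℝ → ℝ) :
    Dform L A n (g ∘ φ) ≤ Dform L A (n + m) g := by
  induction m generalizing φ g with
  | zero =>
    rw [isCell_zero] at hφ
    subst hφ
    exact le_rfl
  | succ m ih =>
    obtain ⟨a, ha, ψ, hψ, rfl⟩ := isCell_succ.1 hφ
    exact (ih hψ (g ∘ Psi L a)).trans (Dform_Psi_le hL ha g)

lemma sum_biUnion_le' {α β : Type*} [DecidableEq β] (s : Finset α) (t : α → Finset β)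
    (f : β → ℝ) (hf : ∀ b, 0 ≤ f b) :
    ∑ b ∈ s.biUnion t, f b ≤ ∑ a ∈ s, ∑ b ∈ t a, f b := by
  induction s using Finset.induction_on with
  | empty => simp
  | insert a s ha ih =>
    rw [Finset.biUnion_insert, Finset.sum_insert ha]
    have h1 := Finset.sum_union_inter (s₁ := t a) (s₂ := s.biUnion t) (f := f)
    have h2 : 0 ≤ ∑ b ∈ t a ∩ s.biUnion t, f b := Finset.sum_nonneg fun b _ => hf b
    linarith

lemma Dform_succ_le {L : ℕ} {A : Finset (ℕ × ℕ)} (hL : 3 ≤ L) (n : ℕ) (g : ℝ × ℝ → ℝ) :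
    Dform L A (n + 1) g ≤ ∑ a ∈ A, Dform L A n (g ∘ Psi L a) := by
  have hE : EN L A (n + 1)
      = A.biUnion fun a => (EN L A n).image (Prod.map (Psi L a) (Psi L a)) := by
    ext z
    rw [mem_EN, adj_succ, Finset.mem_biUnion]
    constructor
    · rintro ⟨a, ha, x', y', h, h1, h2⟩
      refine ⟨a, ha, Finset.mem_image.2 ⟨(x', y'), mem_EN.2 h, ?_⟩⟩
      exact Prod.ext h1.symm h2.symm
    · rintro ⟨a, ha, h⟩
      obtain ⟨y, hy, rfl⟩ := Finset.mem_image.1 h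
      exact ⟨a, ha, y.1, y.2, mem_EN.1 hy, rfl, rfl⟩
  rw [Dform_eq, hE]
  have h1 := sum_biUnion_le' A (fun a => (EN L A n).image (Prod.map (Psi L a) (Psi L a)))
    (fun z => (g z.1 - g z.2) ^ 2) (fun z => sq_nonneg _)
  have h2 : ∀ a ∈ A, ∑ z ∈ (EN L A n).image (Prod.map (Psi L a) (Psi L a)), (g z.1 - g z.2) ^ 2
      = 2 * Dform L A n (g ∘ Psi L a) := by
    intro a _
    rw [Dform_eq, Finset.sum_image ((Psi_injective hL a).prodMap (Psi_injective hL a)).injOn]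
    simp [Prod.map]
  rw [Finset.sum_congr rfl h2, ← Finset.mul_sum] at h1
  linarith

lemma Dform_affine (L : ℕ) (A : Finset (ℕ × ℕ)) (n : ℕ) (g : ℝ × ℝ → ℝ) (s t : ℝ) :
    Dform L A n (fun x => s * g x + t) = s ^ 2 * Dform L A n g := by
  rw [Dform_eq, Dform_eq, mul_left_comm]
  congr 1
  rw [Finset.mul_sum]
  apply Finset.sum_congr rfl
  intro z _
  ring

lemma sq_le_Dform {L : ℕ} {A : Finset (ℕ × ℕ)} {n : ℕ} {x y : ℝ × ℝ} (h : Adj L A n x y)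
    (g : ℝ × ℝ → ℝ) : (g x - g y) ^ 2 ≤ 2 * Dform L A n g := by
  rw [Dform_eq]
  have := Finset.single_le_sum (f := fun z : (ℝ × ℝ) × (ℝ × ℝ) => (g z.1 - g z.2) ^ 2)
    (s := EN L A n) (fun z _ => sq_nonneg _) ((mem_EN (z := (x, y))).2 h)
  simp only at this
  linarith

/-! ### Corners -/

lemma mem_V0 {p : ℝ × ℝ} : p ∈ V0 ↔ p = (0, 0) ∨ p = (1, 0) ∨ p = (1, 1) ∨ p = (0, 1) := by
  simp [V0]

lemma adj_bottom (L : ℕ) (A : Finset (ℕ × ℕ)) : Adj L A 0 (0, 0) (1, 0) :=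
  adj_zero.2 ⟨by simp [V0], by simp [V0], by simp [eudist]⟩

lemma eudist_comm (x y : ℝ × ℝ) : eudist x y = eudist y x := by
  unfold eudist
  congr 1
  ring

lemma adj_symm {L : ℕ} {A : Finset (ℕ × ℕ)} {n : ℕ} {x y : ℝ × ℝ} (h : Adj L A n x y) :
    Adj L A n y x := by
  obtain ⟨w, p, hp, q, hq, h, h1, h2⟩ := h
  exact ⟨w, q, hq, p, hp, by rw [eudist_comm, h], h2, h1⟩

/-- Conductance from corner to corner is bounded below. -/
lemma exists_corner_bound {L : ℕ} {A : Finset (ℕ × ℕ)} (h : GoodCarpet L A) (n : ℕ) :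
    ∃ C : ℝ, 0 < C ∧ ∀ g : ℝ × ℝ → ℝ, (g (0, 0) - g (1, 0)) ^ 2 ≤ C * Dform L A n g := by
  have hL := h.three_le
  have hL0 : (0 : ℝ) < L := by positivity
  induction n with
  | zero => exact ⟨2, by norm_num, fun g => sq_le_Dform (adj_bottom L A) g⟩
  | succ n ih =>
    obtain ⟨C, hC, hg⟩ := ih
    refine ⟨L ^ 2 * C, by positivity, fun g => ?_⟩
    set D := Dform L A (n + 1) g with hD
    have hD0 : 0 ≤ D := Dform_nonneg _ _ _ _
    let u : ℕ → ℝ := fun i => g ((i : ℝ) / L, 0)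
    have hstep : ∀ i ∈ Finset.range L, |u (i + 1) - u i| ≤ Real.sqrt (C * D) := by
      intro i hi
      have hi' := Finset.mem_range.1 hi
      have ha : (i, 0) ∈ A := h.flat_border i 0 hi' (by omega) (by simp)
      have h1 := hg (g ∘ Psi L (i, 0))
      have h2 := Dform_Psi_le (n := n) hL ha g
      apply Real.abs_le_sqrt
      have e1 : (g ∘ Psi L (i, 0)) (0, 0) = u i := by simp [u, Psi]
      have e2 : (g ∘ Psi L (i, 0)) (1, 0) = u (i + 1) := by
        simp [u, Psi, add_comm]
      rw [e1, e2] at h1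
      calc (u (i + 1) - u i) ^ 2 = (u i - u (i + 1)) ^ 2 := by ring
        _ ≤ _ := h1
        _ ≤ _ := mul_le_mul_of_nonneg_left h2 hC.le
    have hsum := Finset.sum_range_sub u L
    have e0 : u 0 = g (0, 0) := by simp [u]
    have eL : u L = g (1, 0) := by simp [u, hL0.ne']
    rw [e0, eL] at hsum
    have habs : |g (1, 0) - g (0, 0)| ≤ L * Real.sqrt (C * D) := by
      rw [← hsum]
      refine (Finset.abs_sum_le_sum_abs _ _).trans ?_
      refine (Finset.sum_le_sum hstep).trans ?_
      simp
    have hs : Real.sqrt (C * D) ^ 2 = C * D := Real.sq_sqrt (by positivity)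
    calc (g (0, 0) - g (1, 0)) ^ 2 = |g (1, 0) - g (0, 0)| ^ 2 := by rw [sq_abs]; ring
      _ ≤ (L * Real.sqrt (C * D)) ^ 2 := pow_le_pow_left₀ (abs_nonneg _) habs 2
      _ = L ^ 2 * C * D := by rw [mul_pow, hs]; ring

/-! ### Resistance bounds -/

/-- The energy infimum whose inverse is `RR`. -/
noncomputable def energyInf (L : ℕ) (A : Finset (ℕ × ℕ)) (n : ℕ) : ℝ :=
  sInf {e : ℝ | ∃ f : ℝ × ℝ → ℝ,
      (∀ x ∈ ({((0 : ℝ), (0 : ℝ))} : Set (ℝ × ℝ)), f x = 1) ∧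
      (∀ x ∈ ({((1 : ℝ), (0 : ℝ))} : Set (ℝ × ℝ)), f x = 0) ∧ e = Dform L A n f}

lemma RR_eq (L : ℕ) (A : Finset (ℕ × ℕ)) (n : ℕ) : RR L A n = (energyInf L A n)⁻¹ := rfl

lemma energyInf_le {L : ℕ} {A : Finset (ℕ × ℕ)} {n : ℕ} {f : ℝ × ℝ → ℝ}
    (h0 : f (0, 0) = 1) (h1 : f (1, 0) = 0) : energyInf L A n ≤ Dform L A n f := by
  apply csInf_le
  · refine ⟨0, ?_⟩
    rintro e ⟨f, -, -, rfl⟩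
    exact Dform_nonneg _ _ _ _
  · exact ⟨f, by simpa using h0, by simpa using h1, rfl⟩

lemma energyInf_pos {L : ℕ} {A : Finset (ℕ × ℕ)} (h : GoodCarpet L A) (n : ℕ) :
    0 < energyInf L A n := by
  obtain ⟨C, hC, hg⟩ := exists_corner_bound h n
  refine lt_of_lt_of_le (inv_pos.2 hC) ?_
  apply le_csInf
  · exact ⟨_, fun x => 1 - x.1, by simp, by simp, rfl⟩
  · rintro e ⟨f, h0, h1, rfl⟩
    have := hg f
    rw [h0 _ rfl, h1 _ rfl] at this
    rw [inv_le_iff_one_le_mul₀' hC]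
    linarith

lemma RR_pos {L : ℕ} {A : Finset (ℕ × ℕ)} (h : GoodCarpet L A) (n : ℕ) : 0 < RR L A n :=
  inv_pos.2 (energyInf_pos h n)

lemma corner_le_RR {L : ℕ} {A : Finset (ℕ × ℕ)} (h : GoodCarpet L A) (n : ℕ) (g : ℝ × ℝ → ℝ) :
    (g (0, 0) - g (1, 0)) ^ 2 ≤ RR L A n * Dform L A n g := by
  have hpos := energyInf_pos h n
  by_cases hd : g (0, 0) - g (1, 0) = 0
  · rw [hd]
    have := mul_nonneg (RR_pos h n).le (Dform_nonneg L A n g)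
    simpa using this
  · set d := g (0, 0) - g (1, 0) with hdd
    have h1 : energyInf L A n ≤ Dform L A n (fun x => d⁻¹ * g x + (-(d⁻¹ * g (1, 0)))) := by
      apply energyInf_le
      · rw [← sub_eq_add_neg, ← mul_sub, ← hdd, inv_mul_cancel₀ hd]
      · ring
    rw [Dform_affine] at h1
    rw [RR_eq, ← div_eq_inv_mul, le_div_iff₀ hpos]
    have h2 : 0 < d ^ 2 := by positivity
    calc d ^ 2 * energyInf L A n ≤ d ^ 2 * (d⁻¹ ^ 2 * Dform L A n g) :=
          mul_le_mul_of_nonneg_left h1 h2.le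
      _ = Dform L A n g := by field_simp

/-! ### Symmetries -/

lemma adj_swap {L : ℕ} {A : Finset (ℕ × ℕ)} (h : GoodCarpet L A) {n : ℕ} {x y : ℝ × ℝ}
    (hxy : Adj L A n x y) : Adj L A n x.swap y.swap := by
  induction n generalizing x y with
  | zero =>
    obtain ⟨hx, hy, he⟩ := adj_zero.1 hxy
    have key : ∀ p ∈ V0, p.swap ∈ V0 := by
      intro p hp
      rcases mem_V0.1 hp with rfl | rfl | rfl | rfl <;> simp [V0]
    refine adj_zero.2 ⟨key x hx, key y hy, ?_⟩
    rw [← he]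
    simp only [eudist, Prod.fst_swap, Prod.snd_swap]
    congr 1
    ring
  | succ n ih =>
    obtain ⟨a, ha, x', y', h', rfl, rfl⟩ := adj_succ.1 hxy
    exact adj_succ.2 ⟨(a.2, a.1), h.symm_swap _ _ ha, _, _, ih h', rfl, rfl⟩

/-- Reflection in the vertical midline. -/
def refl1 (x : ℝ × ℝ) : ℝ × ℝ := (1 - x.1, x.2)

lemma adj_refl1 {L : ℕ} {A : Finset (ℕ × ℕ)} (h : GoodCarpet L A) {n : ℕ} {x y : ℝ × ℝ}
    (hxy : Adj L A n x y) : Adj L A n (refl1 x) (refl1 y) := by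
  have hL := h.three_le
  have hL0 : (0 : ℝ) < L := by positivity
  induction n generalizing x y with
  | zero =>
    obtain ⟨hx, hy, he⟩ := adj_zero.1 hxy
    have key : ∀ p ∈ V0, refl1 p ∈ V0 := by
      intro p hp
      rcases mem_V0.1 hp with rfl | rfl | rfl | rfl <;> simp [V0, refl1]
    refine adj_zero.2 ⟨key x hx, key y hy, ?_⟩
    rw [← he]
    simp only [eudist, refl1]
    congr 1
    ring
  | succ n ih =>
    obtain ⟨a, ha, x', y', h', rfl, rfl⟩ := adj_succ.1 hxy
    have hlt := (h.mem_lt a ha).1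
    have hcast : ((L - 1 - a.1 : ℕ) : ℝ) = L - 1 - a.1 := by
      rw [Nat.cast_sub (by omega), Nat.cast_sub (by omega)]
      simp
    have key : ∀ z, refl1 (Psi L a z) = Psi L (L - 1 - a.1, a.2) (refl1 z) := by
      intro z
      simp only [refl1, Psi, hcast]
      ext
      · field_simp; ring
      · rfl
    exact adj_succ.2 ⟨_, h.symm_reflect _ _ ha, _, _, ih h', key _, key _⟩

lemma Dform_swap_le {L : ℕ} {A : Finset (ℕ × ℕ)} (h : GoodCarpet L A) (n : ℕ) (g : ℝ × ℝ → ℝ) :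
    Dform L A n (g ∘ Prod.swap) ≤ Dform L A n g :=
  Dform_comp_le Prod.swap_injective (fun _ _ hxy => adj_swap h hxy) g

lemma Dform_refl1_le {L : ℕ} {A : Finset (ℕ × ℕ)} (h : GoodCarpet L A) (n : ℕ) (g : ℝ × ℝ → ℝ) :
    Dform L A n (g ∘ refl1) ≤ Dform L A n g := by
  refine Dform_comp_le ?_ (fun _ _ hxy => adj_refl1 h hxy) g
  intro x y hxy
  simp only [refl1, Prod.mk.injEq] at hxy
  ext <;> linarith [hxy.1, hxy.2]

lemma edge_le_RR {L : ℕ} {A : Finset (ℕ × ℕ)} (h : GoodCarpet L A) (n : ℕ) (g : ℝ × ℝ → ℝ)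
    {p q : ℝ × ℝ} (hp : p ∈ V0) (hq : q ∈ V0) (hpq : eudist p q = 1) :
    (g p - g q) ^ 2 ≤ RR L A n * Dform L A n g := by
  have hR := (RR_pos h n).le
  have h1 : ∀ g : ℝ × ℝ → ℝ, (g (0, 0) - g (1, 0)) ^ 2 ≤ RR L A n * Dform L A n g :=
    corner_le_RR h n
  have h2 : ∀ g : ℝ × ℝ → ℝ, (g (0, 0) - g (0, 1)) ^ 2 ≤ RR L A n * Dform L A n g := fun g =>
    (h1 (g ∘ Prod.swap)).trans (mul_le_mul_of_nonneg_left (Dform_swap_le h n g) hR)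
  have h3 : ∀ g : ℝ × ℝ → ℝ, (g (1, 0) - g (1, 1)) ^ 2 ≤ RR L A n * Dform L A n g := fun g => by
    have := (h2 (g ∘ refl1)).trans (mul_le_mul_of_nonneg_left (Dform_refl1_le h n g) hR)
    simpa [refl1] using this
  have h4 : ∀ g : ℝ × ℝ → ℝ, (g (0, 1) - g (1, 1)) ^ 2 ≤ RR L A n * Dform L A n g := fun g =>
    (h3 (g ∘ Prod.swap)).trans (mul_le_mul_of_nonneg_left (Dform_swap_le h n g) hR)
  rcases mem_V0.1 hp with rfl | rfl | rfl | rfl <;>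
    rcases mem_V0.1 hq with rfl | rfl | rfl | rfl <;>
    first
      | exact h1 g
      | exact h2 g
      | exact h3 g
      | exact h4 g
      | (rw [sub_sq_comm]; exact h1 g)
      | (rw [sub_sq_comm]; exact h2 g)
      | (rw [sub_sq_comm]; exact h3 g)
      | (rw [sub_sq_comm]; exact h4 g)
      | (exfalso; simp [eudist] at hpq)

lemma adj_diff_le {L : ℕ} {A : Finset (ℕ × ℕ)} (h : GoodCarpet L A) (n m : ℕ) (f : ℝ × ℝ → ℝ)
    {x y : ℝ × ℝ} (hxy : Adj L A m x y) :
    (f x - f y) ^ 2 ≤ RR L A n * Dform L A (n + m) f := by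
  obtain ⟨φ, hφ, p, hp, q, hq, he, rfl, rfl⟩ := adj_iff.1 hxy
  exact (edge_le_RR h n (f ∘ φ) hp hq he).trans
    (mul_le_mul_of_nonneg_left (Dform_cell_le h.three_le hφ f) (RR_pos h n).le)

/-! ### Exponential growth of the resistance -/

/-- The growth rate `L² / (L² - 1)`. -/
noncomputable def lam (L : ℕ) : ℝ := (L : ℝ) ^ 2 / ((L : ℝ) ^ 2 - 1)

lemma lam_gt_one {L : ℕ} (hL : 3 ≤ L) : 1 < lam L := by
  have : (3 : ℝ) ≤ L := by exact_mod_cast hL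
  rw [lam, lt_div_iff₀ (by nlinarith)]
  linarith

lemma lam_lt {L : ℕ} (hL : 3 ≤ L) : lam L < L := by
  have : (3 : ℝ) ≤ L := by exact_mod_cast hL
  rw [lam, div_lt_iff₀ (by nlinarith)]
  nlinarith

lemma card_le {L : ℕ} {A : Finset (ℕ × ℕ)} (h : GoodCarpet L A) :
    (A.card : ℝ) ≤ (L : ℝ) ^ 2 - 1 := by
  obtain ⟨a, b, ha, hb, hab⟩ := h.proper
  have hss : A ⊂ Finset.range L ×ˢ Finset.range L := by
    rw [Finset.ssubset_iff_of_subset]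
    · exact ⟨(a, b), by simp [ha, hb], hab⟩
    · intro p hp
      have := h.mem_lt p hp
      simp [this]
  have := Finset.card_lt_card hss
  rw [Finset.card_product, Finset.card_range] at this
  have h2 : (A.card : ℝ) + 1 ≤ (L : ℝ) * L := by exact_mod_cast this
  nlinarith

/-- The linear test function. -/
def lin (x : ℝ × ℝ) : ℝ := 1 - x.1

lemma Dform_lin_le {L : ℕ} {A : Finset (ℕ × ℕ)} (h : GoodCarpet L A) (n : ℕ) :
    lam L ^ n * Dform L A n lin ≤ Dform L A 0 lin := by
  have hL := h.three_le
  have hL3 : (3 : ℝ) ≤ L := by exact_mod_cast hL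
  have hl := lam_gt_one hL
  induction n with
  | zero => simp
  | succ n ih =>
    have h1 := Dform_succ_le (A := A) hL n lin
    have h2 : ∀ a ∈ A, Dform L A n (lin ∘ Psi L a) = ((L : ℝ)⁻¹) ^ 2 * Dform L A n lin := by
      intro a _
      rw [← Dform_affine L A n lin (L : ℝ)⁻¹ (1 - (L : ℝ)⁻¹ - (L : ℝ)⁻¹ * a.1)]
      congr 1
      funext x
      simp only [lin, Psi, Function.comp]
      ring
    rw [Finset.sum_congr rfl h2, Finset.sum_const, nsmul_eq_mul] at h1
    have hD := Dform_nonneg L A n lin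
    have hl0 : 0 < lam L := by linarith
    have hpos : (0 : ℝ) < (L : ℝ) ^ 2 - 1 := by nlinarith
    have hprod : lam L * (((L : ℝ) ^ 2 - 1) * ((L : ℝ)⁻¹) ^ 2) = 1 := by
      rw [lam]
      field_simp
    have hc := card_le h
    have h3 : Dform L A (n + 1) lin
        ≤ (((L : ℝ) ^ 2 - 1) * ((L : ℝ)⁻¹) ^ 2) * Dform L A n lin := by
      refine h1.trans ?_
      rw [← mul_assoc]
      gcongr
    calc lam L ^ (n + 1) * Dform L A (n + 1) lin
        ≤ lam L ^ (n + 1) * ((((L : ℝ) ^ 2 - 1) * ((L : ℝ)⁻¹) ^ 2) * Dform L A n lin) := by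
          gcongr
      _ = lam L ^ n * Dform L A n lin *
            (lam L * (((L : ℝ) ^ 2 - 1) * ((L : ℝ)⁻¹) ^ 2)) := by ring
      _ = lam L ^ n * Dform L A n lin := by rw [hprod, mul_one]
      _ ≤ _ := ih

lemma lam_pow_le_RR {L : ℕ} {A : Finset (ℕ × ℕ)} (h : GoodCarpet L A) (n : ℕ) :
    lam L ^ n ≤ Dform L A 0 lin * RR L A n := by
  have hpos := energyInf_pos h n
  have h1 : energyInf L A n ≤ Dform L A n lin := energyInf_le (by simp [lin]) (by simp [lin])
  have hl := lam_gt_one h.three_le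
  rw [RR_eq, ← div_eq_mul_inv, le_div_iff₀ hpos]
  refine le_trans ?_ (Dform_lin_le h n)
  gcongr

lemma exists_good_n {L : ℕ} {A : Finset (ℕ × ℕ)} (h : GoodCarpet L A) (m : ℕ) :
    ∃ n, lam L ^ m * RR L A n ≤ 2 * RR L A (n + m) := by
  by_contra! hcon
  have hl := lam_gt_one h.three_le
  have hlp : 0 < lam L ^ m := by positivity
  have hind : ∀ k : ℕ, 2 ^ k * RR L A (k * m) ≤ (lam L ^ m) ^ k * RR L A 0 := by
    intro k
    induction k with
    | zero => simp
    | succ k ih =>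
      have h1 := (hcon (k * m)).le
      rw [show (k + 1) * m = k * m + m by ring]
      calc 2 ^ (k + 1) * RR L A (k * m + m) = 2 ^ k * (2 * RR L A (k * m + m)) := by ring
        _ ≤ 2 ^ k * (lam L ^ m * RR L A (k * m)) := by gcongr
        _ = lam L ^ m * (2 ^ k * RR L A (k * m)) := by ring
        _ ≤ lam L ^ m * ((lam L ^ m) ^ k * RR L A 0) := by gcongr
        _ = _ := by ring
  obtain ⟨k, hk⟩ := pow_unbounded_of_one_lt (Dform L A 0 lin * RR L A 0) (one_lt_two : (1:ℝ) < 2)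
  have h1 := hind k
  have h2 := lam_pow_le_RR h (k * m)
  have hD := Dform_nonneg L A 0 lin
  have hp : 0 < (lam L ^ m) ^ k := by positivity
  have e : lam L ^ (k * m) = (lam L ^ m) ^ k := by rw [mul_comm, pow_mul]
  rw [e] at h2
  have h3 : 2 ^ k * (lam L ^ m) ^ k ≤ (Dform L A 0 lin * RR L A 0) * (lam L ^ m) ^ k := by
    calc 2 ^ k * (lam L ^ m) ^ k ≤ 2 ^ k * (Dform L A 0 lin * RR L A (k * m)) := by gcongr
      _ = Dform L A 0 lin * (2 ^ k * RR L A (k * m)) := by ring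
      _ ≤ Dform L A 0 lin * ((lam L ^ m) ^ k * RR L A 0) := by gcongr
      _ = _ := by ring
  have h4 := le_of_mul_le_mul_right h3 hp
  linarith

lemma adj_diff_decay {L : ℕ} {A : Finset (ℕ × ℕ)} (h : GoodCarpet L A) {f : ℝ × ℝ → ℝ} {M : ℝ}
    (hM : ∀ n : ℕ, RR L A n * Dform L A n f ≤ M) (m : ℕ) {x y : ℝ × ℝ} (hxy : Adj L A m x y) :
    lam L ^ m * (f x - f y) ^ 2 ≤ 2 * M := by
  obtain ⟨n, hn⟩ := exists_good_n h m
  have h1 := adj_diff_le h n m f hxy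
  have hl := lam_gt_one h.three_le
  have hD := Dform_nonneg L A (n + m) f
  calc lam L ^ m * (f x - f y) ^ 2 ≤ lam L ^ m * (RR L A n * Dform L A (n + m) f) := by gcongr
    _ = (lam L ^ m * RR L A n) * Dform L A (n + m) f := by ring
    _ ≤ 2 * RR L A (n + m) * Dform L A (n + m) f := by gcongr
    _ ≤ 2 * M := by linarith [hM (n + m)]

/-! ### Neighbouring cells share a corner -/

lemma share_one {i j : ℕ} {s t : ℝ} (hs0 : 0 ≤ s) (hs1 : s ≤ 1) (ht0 : 0 ≤ t) (ht1 : t ≤ 1)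
    (hd : |(s + i) - (t + j)| < 1) :
    ∃ e e' : ℝ, (e = 0 ∨ e = 1) ∧ (e' = 0 ∨ e' = 1) ∧ e + i = e' + j := by
  rw [abs_lt] at hd
  have h1 : (i : ℝ) < j + 2 := by linarith
  have h2 : (j : ℝ) < i + 2 := by linarith
  have h1' : i < j + 2 := by exact_mod_cast h1
  have h2' : j < i + 2 := by exact_mod_cast h2
  have : i = j ∨ i = j + 1 ∨ j = i + 1 := by omega
  rcases this with rfl | rfl | rfl
  · exact ⟨0, 0, by simp, by simp, rfl⟩
  · exact ⟨0, 1, by simp, by simp, by push_cast; ring⟩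
  · exact ⟨1, 0, by simp, by simp, by push_cast; ring⟩

lemma mem_V0_of {e e' : ℝ} (h : e = 0 ∨ e = 1) (h' : e' = 0 ∨ e' = 1) : (e, e') ∈ V0 := by
  rcases h with rfl | rfl <;> rcases h' with rfl | rfl <;> simp [V0]

/-- The closed unit square. -/
abbrev Q : Set (ℝ × ℝ) := Set.Icc (((0 : ℝ), (0 : ℝ)) : ℝ × ℝ) ((1 : ℝ), (1 : ℝ))

lemma mem_Q {x : ℝ × ℝ} : x ∈ Q ↔ 0 ≤ x.1 ∧ x.1 ≤ 1 ∧ 0 ≤ x.2 ∧ x.2 ≤ 1 := by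
  simp only [Q, Set.mem_Icc, Prod.le_def]
  tauto

lemma share_corner {L : ℕ} {A : Finset (ℕ × ℕ)} (hL : 3 ≤ L) {m : ℕ} {φ ψ : ℝ × ℝ → ℝ × ℝ}
    (hφ : IsCell L A m φ) (hψ : IsCell L A m ψ) {x y : ℝ × ℝ} (hx : x ∈ Q) (hy : y ∈ Q)
    (h1 : |(φ x).1 - (ψ y).1| * (L : ℝ) ^ m < 1) (h2 : |(φ x).2 - (ψ y).2| * (L : ℝ) ^ m < 1) :
    ∃ p ∈ V0, ∃ q ∈ V0, φ p = ψ q := by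
  obtain ⟨i, j, hij⟩ := isCell_form hL hφ
  obtain ⟨i', j', hij'⟩ := isCell_form hL hψ
  have hP : (0 : ℝ) < (L : ℝ) ^ m := by positivity
  rw [mem_Q] at hx hy
  obtain ⟨a1, a2, a3, a4⟩ := hx
  obtain ⟨b1, b2, b3, b4⟩ := hy
  have key : ∀ u v : ℝ, |u / (L : ℝ) ^ m - v / (L : ℝ) ^ m| * (L : ℝ) ^ m = |u - v| := by
    intro u v
    rw [← sub_div, abs_div, abs_of_pos hP, div_mul_cancel₀ _ hP.ne']
  simp only [hij, hij', key] at h1 h2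
  obtain ⟨e, e', he, he', hee⟩ := share_one a1 a2 b1 b2 h1
  obtain ⟨d, d', hd, hd', hdd⟩ := share_one a3 a4 b3 b4 h2
  refine ⟨(e, d), mem_V0_of he hd, (e', d'), mem_V0_of he' hd', ?_⟩
  rw [hij, hij']
  simp only [hee, hdd]

/-! ### Level-one connectivity -/

/-- `u` and `v` are joined by a bounded number of level-one edges (phrased through functions). -/
def Rel1 (L : ℕ) (A : Finset (ℕ × ℕ)) (u v : ℝ × ℝ) : Prop :=
  ∃ K : ℝ, 0 ≤ K ∧ ∀ (g : ℝ × ℝ → ℝ) (δ : ℝ), 0 ≤ δ →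
    (∀ x y, Adj L A 1 x y → |g x - g y| ≤ δ) → |g u - g v| ≤ K * δ

lemma Rel1.refl {L : ℕ} {A : Finset (ℕ × ℕ)} (u : ℝ × ℝ) : Rel1 L A u u :=
  ⟨0, le_rfl, fun g δ _ _ => by simp⟩

lemma Rel1.symm {L : ℕ} {A : Finset (ℕ × ℕ)} {u v : ℝ × ℝ} (h : Rel1 L A u v) :
    Rel1 L A v u := by
  obtain ⟨K, hK, H⟩ := h
  exact ⟨K, hK, fun g δ hδ hg => by rw [abs_sub_comm]; exact H g δ hδ hg⟩

lemma Rel1.trans {L : ℕ} {A : Finset (ℕ × ℕ)} {u v w : ℝ × ℝ} (h : Rel1 L A u v)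
    (h' : Rel1 L A v w) : Rel1 L A u w := by
  obtain ⟨K, hK, H⟩ := h
  obtain ⟨K', hK', H'⟩ := h'
  refine ⟨K + K', by positivity, fun g δ hδ hg => ?_⟩
  have := abs_sub_le (g u) (g v) (g w)
  have h1 := H g δ hδ hg
  have h2 := H' g δ hδ hg
  linarith

lemma Rel1.of_adj {L : ℕ} {A : Finset (ℕ × ℕ)} {u v : ℝ × ℝ} (h : Adj L A 1 u v) :
    Rel1 L A u v :=
  ⟨1, zero_le_one, fun g δ _ hg => by simpa using hg u v h⟩

lemma rel1_corner0 {L : ℕ} {A : Finset (ℕ × ℕ)} {a : ℕ × ℕ} (ha : a ∈ A) {p : ℝ × ℝ}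
    (hp : p ∈ V0) : Rel1 L A (Psi L a (0, 0)) (Psi L a p) := by
  have key : ∀ p q : ℝ × ℝ, p ∈ V0 → q ∈ V0 → eudist p q = 1 →
      Rel1 L A (Psi L a p) (Psi L a q) := fun p q hp hq h =>
    Rel1.of_adj (adj_succ.2 ⟨a, ha, p, q, adj_zero.2 ⟨hp, hq, h⟩, rfl, rfl⟩)
  have k1 : Rel1 L A (Psi L a (0, 0)) (Psi L a (1, 0)) :=
    key _ _ (by simp [V0]) (by simp [V0]) (by simp [eudist])
  rcases mem_V0.1 hp with rfl | rfl | rfl | rfl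
  · exact Rel1.refl _
  · exact k1
  · exact k1.trans (key _ _ (by simp [V0]) (by simp [V0]) (by simp [eudist]))
  · exact key _ _ (by simp [V0]) (by simp [V0]) (by simp [eudist])

lemma isCell_one {L : ℕ} {A : Finset (ℕ × ℕ)} {a : ℕ × ℕ} (ha : a ∈ A) :
    IsCell L A 1 (Psi L a) :=
  isCell_succ.2 ⟨a, ha, id, isCell_zero.2 rfl, rfl⟩

/-- The closed cell with index `p`. -/
def box (L : ℕ) (p : ℕ × ℕ) : Set (ℝ × ℝ) :=
  Set.Icc (((p.1 : ℝ) / L, (p.2 : ℝ) / L) : ℝ × ℝ)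
      ((((p.1 : ℝ) + 1) / L, ((p.2 : ℝ) + 1) / L) : ℝ × ℝ)

lemma box_preimage {L : ℕ} (hL : 3 ≤ L) {a : ℕ × ℕ} {z : ℝ × ℝ} (hz : z ∈ box L a) :
    ∃ x ∈ Q, Psi L a x = z := by
  have hL0 : (0 : ℝ) < L := by positivity
  simp only [box, Set.mem_Icc, Prod.le_def] at hz
  obtain ⟨⟨h1, h2⟩, h3, h4⟩ := hz
  rw [div_le_iff₀ hL0] at h1 h2
  rw [le_div_iff₀ hL0] at h3 h4
  refine ⟨(z.1 * L - a.1, z.2 * L - a.2), mem_Q.2 ⟨?_, ?_, ?_, ?_⟩, ?_⟩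
  · simp only; linarith
  · simp only; linarith
  · simp only; linarith
  · simp only; linarith
  · simp [Psi, hL0.ne']

lemma rel1_of_touch {L : ℕ} {A : Finset (ℕ × ℕ)} (hL : 3 ≤ L) {a b : ℕ × ℕ} (ha : a ∈ A)
    (hb : b ∈ A) {z : ℝ × ℝ} (hza : z ∈ box L a) (hzb : z ∈ box L b) :
    Rel1 L A (Psi L a (0, 0)) (Psi L b (0, 0)) := by
  obtain ⟨x, hx, hxz⟩ := box_preimage hL hza
  obtain ⟨y, hy, hyz⟩ := box_preimage hL hzb
  obtain ⟨p, hp, q, hq, hpq⟩ := share_corner hL (isCell_one ha) (isCell_one hb) hx hy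
    (by rw [hxz, hyz]; simp) (by rw [hxz, hyz]; simp)
  have h1 := rel1_corner0 (L := L) ha hp
  rw [hpq] at h1
  exact h1.trans (rel1_corner0 hb hq).symm

lemma box_nonempty {L : ℕ} (hL : 3 ≤ L) (a : ℕ × ℕ) : (box L a).Nonempty := by
  refine ⟨((a.1 : ℝ) / L, (a.2 : ℝ) / L), ?_⟩
  simp only [box, Set.mem_Icc, le_refl, true_and, Prod.le_def]
  constructor <;> (gcongr; linarith)

lemma rel1_cells {L : ℕ} {A : Finset (ℕ × ℕ)} (h : GoodCarpet L A) {a b : ℕ × ℕ} (ha : a ∈ A)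
    (hb : b ∈ A) : Rel1 L A (Psi L a (0, 0)) (Psi L b (0, 0)) := by
  by_contra hcon
  have hL := h.three_le
  let S : Finset (ℕ × ℕ) := A.filter fun c => Rel1 L A (Psi L a (0, 0)) (Psi L c (0, 0))
  let T : Finset (ℕ × ℕ) := A.filter fun c => ¬ Rel1 L A (Psi L a (0, 0)) (Psi L c (0, 0))
  have hclosed : ∀ U : Finset (ℕ × ℕ), IsClosed (⋃ p ∈ U, box L p) := fun U =>
    isClosed_biUnion_finset fun p _ => isClosed_Icc
  have hconn : IsPreconnected (⋃ p ∈ A, box L p) := h.connected.isPreconnected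
  rw [isPreconnected_closed_iff] at hconn
  have hcover : (⋃ p ∈ A, box L p) ⊆ (⋃ p ∈ S, box L p) ∪ (⋃ p ∈ T, box L p) := by
    intro z hz
    simp only [Set.mem_iUnion] at hz
    obtain ⟨c, hc, hz⟩ := hz
    by_cases hr : Rel1 L A (Psi L a (0, 0)) (Psi L c (0, 0))
    · exact Or.inl (Set.mem_biUnion (Finset.mem_filter.2 ⟨hc, hr⟩) hz)
    · exact Or.inr (Set.mem_biUnion (Finset.mem_filter.2 ⟨hc, hr⟩) hz)
  obtain ⟨za, hza⟩ := box_nonempty hL a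
  obtain ⟨zb, hzb⟩ := box_nonempty hL b
  obtain ⟨z, -, hz1, hz2⟩ := hconn _ _ (hclosed S) (hclosed T) hcover
    ⟨za, Set.mem_biUnion ha hza,
      Set.mem_biUnion (Finset.mem_filter.2 ⟨ha, Rel1.refl _⟩) hza⟩
    ⟨zb, Set.mem_biUnion hb hzb,
      Set.mem_biUnion (Finset.mem_filter.2 ⟨hb, hcon⟩) hzb⟩
  simp only [Set.mem_iUnion] at hz1 hz2
  obtain ⟨c, hc, hzc⟩ := hz1
  obtain ⟨d, hd, hzd⟩ := hz2
  obtain ⟨hcA, hcr⟩ := Finset.mem_filter.1 hc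
  obtain ⟨hdA, hdr⟩ := Finset.mem_filter.1 hd
  exact hdr (hcr.trans (rel1_of_touch hL hcA hdA hzc hzd))

lemma rel1_all {L : ℕ} {A : Finset (ℕ × ℕ)} (h : GoodCarpet L A) {u v : ℝ × ℝ}
    (hu : u ∈ VN L A 1) (hv : v ∈ VN L A 1) : Rel1 L A u v := by
  have key : ∀ u ∈ VN L A 1, ∃ a ∈ A, Rel1 L A (Psi L a (0, 0)) u := by
    intro u hu
    obtain ⟨φ, hφ, p, hp, rfl⟩ := mem_VN.1 hu
    obtain ⟨a, ha, ψ, hψ, rfl⟩ := isCell_succ.1 hφ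
    rw [isCell_zero] at hψ
    subst hψ
    exact ⟨a, ha, rel1_corner0 ha hp⟩
  obtain ⟨a, ha, h1⟩ := key u hu
  obtain ⟨b, hb, h2⟩ := key v hv
  exact h1.symm.trans ((rel1_cells h ha hb).trans h2)

lemma exists_K {L : ℕ} {A : Finset (ℕ × ℕ)} (h : GoodCarpet L A) :
    ∃ K : ℝ, 0 ≤ K ∧ ∀ u ∈ VN L A 1, ∀ v ∈ VN L A 1, ∀ (g : ℝ × ℝ → ℝ) (δ : ℝ), 0 ≤ δ →
      (∀ x y, Adj L A 1 x y → |g x - g y| ≤ δ) → |g u - g v| ≤ K * δ := by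
  have hex : ∀ z : (ℝ × ℝ) × (ℝ × ℝ), ∃ K : ℝ, 0 ≤ K ∧ (z ∈ VN L A 1 ×ˢ VN L A 1 →
      ∀ (g : ℝ × ℝ → ℝ) (δ : ℝ), 0 ≤ δ →
      (∀ x y, Adj L A 1 x y → |g x - g y| ≤ δ) → |g z.1 - g z.2| ≤ K * δ) := by
    intro z
    by_cases hz : z ∈ VN L A 1 ×ˢ VN L A 1
    · obtain ⟨h1, h2⟩ := Finset.mem_product.1 hz
      obtain ⟨K, hK, H⟩ := rel1_all h h1 h2
      exact ⟨K, hK, fun _ => H⟩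
    · exact ⟨0, le_rfl, fun hh => absurd hh hz⟩
  choose k hk0 hk using hex
  refine ⟨∑ z ∈ VN L A 1 ×ˢ VN L A 1, k z, Finset.sum_nonneg fun z _ => hk0 z, ?_⟩
  intro u hu v hv g δ hδ hg
  have hz : (u, v) ∈ VN L A 1 ×ˢ VN L A 1 := Finset.mem_product.2 ⟨hu, hv⟩
  refine (hk (u, v) hz g δ hδ hg).trans ?_
  gcongr
  exact Finset.single_le_sum (f := k) (fun z _ => hk0 z) hz

lemma V0_subset {L : ℕ} {A : Finset (ℕ × ℕ)} (h : GoodCarpet L A) {p : ℝ × ℝ} (hp : p ∈ V0) :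
    p ∈ VN L A 1 := by
  have hL := h.three_le
  have hL0 : (L : ℝ) ≠ 0 := by positivity
  have hc : ((L - 1 : ℕ) : ℝ) = L - 1 := by
    rw [Nat.cast_sub (by omega)]
    simp
  have key : ∀ a b : ℕ, a < L → b < L → (a = 0 ∨ a = L - 1 ∨ b = 0 ∨ b = L - 1) →
      Psi L (a, b) p = p → p ∈ VN L A 1 := fun a b ha hb hab hh =>
    mem_VN.2 ⟨_, isCell_one (h.flat_border a b ha hb hab), p, hp, hh.symm⟩
  rcases mem_V0.1 hp with rfl | rfl | rfl | rfl
  · exact key 0 0 (by omega) (by omega) (by simp) (by simp [Psi])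
  · exact key (L - 1) 0 (by omega) (by omega) (by simp) (by simp [Psi, hc, hL0])
  · exact key (L - 1) (L - 1) (by omega) (by omega) (by simp) (by simp [Psi, hc, hL0])
  · exact key 0 (L - 1) (by omega) (by omega) (by simp) (by simp [Psi, hc, hL0])

lemma mem_VN_one {L : ℕ} {A : Finset (ℕ × ℕ)} {a : ℕ × ℕ} (ha : a ∈ A) {p : ℝ × ℝ}
    (hp : p ∈ V0) : Psi L a p ∈ VN L A 1 :=
  mem_VN.2 ⟨_, isCell_one ha, p, hp, rfl⟩

/-! ### Chaining -/

lemma chain_bound {L : ℕ} {A : Finset (ℕ × ℕ)} (h : GoodCarpet L A) {K : ℝ} (hK : 0 ≤ K)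
    (HK : ∀ u ∈ VN L A 1, ∀ v ∈ VN L A 1, ∀ (g : ℝ × ℝ → ℝ) (δ : ℝ), 0 ≤ δ →
      (∀ x y, Adj L A 1 x y → |g x - g y| ≤ δ) → |g u - g v| ≤ K * δ)
    {r : ℝ} (hr0 : 0 ≤ r) (hr1 : r < 1) {n : ℕ} {φ : ℝ × ℝ → ℝ × ℝ} (hφ : IsCell L A n φ)
    {g : ℝ × ℝ → ℝ} {B : ℝ} (hB : 0 ≤ B)
    (hg : ∀ k x y, Adj L A k x y → |g x - g y| ≤ B * r ^ k) {p q : ℝ × ℝ} (hp : p ∈ V0)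
    (hq : q ∈ V0) : |g (φ p) - g q| ≤ K * (B * r) / (1 - r) := by
  have hr' : 0 < 1 - r := by linarith
  have hg1 : ∀ x y, Adj L A 1 x y → |g x - g y| ≤ B * r := fun x y hxy => by
    simpa using hg 1 x y hxy
  induction n generalizing φ g B q with
  | zero =>
    rw [isCell_zero] at hφ
    subst hφ
    refine (HK p (V0_subset h hp) q (V0_subset h hq) g (B * r) (by positivity) hg1).trans ?_
    rw [le_div_iff₀ hr']
    have : 0 ≤ K * (B * r) := by positivity
    nlinarith
  | succ n ih =>
    obtain ⟨a, ha, ψ, hψ, rfl⟩ := isCell_succ.1 hφ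
    have hga : ∀ k x y, Adj L A k x y →
        |(g ∘ Psi L a) x - (g ∘ Psi L a) y| ≤ (B * r) * r ^ k := by
      intro k x y hxy
      have := hg (k + 1) _ _ (adj_succ.2 ⟨a, ha, x, y, hxy, rfl, rfl⟩)
      simp only [Function.comp]
      calc _ ≤ _ := this
        _ = _ := by ring
    have h1 := ih hψ (g := g ∘ Psi L a) (B := B * r) (q := q) (by positivity) hga hq
      (fun x y hxy => by simpa using hga 1 x y hxy)
    have h2 := HK (Psi L a q) (mem_VN_one ha hq) q (V0_subset h hq) g (B * r) (by positivity) hg1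
    have h3 := abs_sub_le (g ((Psi L a ∘ ψ) p)) (g (Psi L a q)) (g q)
    simp only [Function.comp] at h1 h3 ⊢
    have h4 : K * (B * r * r) / (1 - r) + K * (B * r) = K * (B * r) / (1 - r) := by
      field_simp
      ring
    linarith

lemma adj_cell {L : ℕ} {A : Finset (ℕ × ℕ)} {m k : ℕ} {φ : ℝ × ℝ → ℝ × ℝ}
    (hφ : IsCell L A m φ) {x y : ℝ × ℝ} (hxy : Adj L A k x y) :
    Adj L A (k + m) (φ x) (φ y) := by
  induction m generalizing φ with
  | zero =>
    rw [isCell_zero] at hφ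
    subst hφ
    exact hxy
  | succ m ih =>
    obtain ⟨a, ha, ψ, hψ, rfl⟩ := isCell_succ.1 hφ
    exact adj_succ.2 ⟨a, ha, _, _, ih hψ, rfl, rfl⟩

/-! ### The carpet -/

lemma mem_carpetF {L : ℕ} {A : Finset (ℕ × ℕ)} {x : ℝ × ℝ} :
    x ∈ carpetF L A ↔ ∀ n, ∃ φ, IsCell L A n φ ∧ ∃ z ∈ Q, φ z = x := by
  simp only [carpetF, Set.mem_iInter, Set.mem_iUnion, Set.mem_image]
  refine forall_congr' fun n => ?_
  constructor
  · rintro ⟨w, z, hz, rfl⟩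
    exact ⟨_, ⟨w, rfl⟩, z, hz, rfl⟩
  · rintro ⟨_, ⟨w, rfl⟩, z, hz, rfl⟩
    exact ⟨w, z, hz, rfl⟩

lemma Psi_mem_Q {L : ℕ} {A : Finset (ℕ × ℕ)} (h : GoodCarpet L A) {a : ℕ × ℕ} (ha : a ∈ A)
    {x : ℝ × ℝ} (hx : x ∈ Q) : Psi L a x ∈ Q := by
  have hL := h.three_le
  have hL0 : (0 : ℝ) < L := by positivity
  obtain ⟨h1, h2⟩ := h.mem_lt a ha
  have h1' : (a.1 : ℝ) + 1 ≤ L := by exact_mod_cast h1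
  have h2' : (a.2 : ℝ) + 1 ≤ L := by exact_mod_cast h2
  obtain ⟨b1, b2, b3, b4⟩ := mem_Q.1 hx
  refine mem_Q.2 ⟨?_, ?_, ?_, ?_⟩
  · simp only [Psi]; positivity
  · simp only [Psi]; rw [div_le_one hL0]; linarith
  · simp only [Psi]; positivity
  · simp only [Psi]; rw [div_le_one hL0]; linarith

lemma level_anti {L : ℕ} {A : Finset (ℕ × ℕ)} (h : GoodCarpet L A) {n : ℕ} {x : ℝ × ℝ}
    (hx : ∃ φ, IsCell L A (n + 1) φ ∧ ∃ z ∈ Q, φ z = x) :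
    ∃ φ, IsCell L A n φ ∧ ∃ z ∈ Q, φ z = x := by
  obtain ⟨φ, hφ, z, hz, rfl⟩ := hx
  obtain ⟨ψ, χ, hψ, hχ, rfl⟩ := isCell_split hφ
  obtain ⟨a, ha, ξ, hξ, rfl⟩ := isCell_succ.1 hχ
  rw [isCell_zero] at hξ
  subst hξ
  exact ⟨ψ, hψ, _, Psi_mem_Q h ha hz, rfl⟩

lemma Psi_mem_carpetF {L : ℕ} {A : Finset (ℕ × ℕ)} (h : GoodCarpet L A) {a : ℕ × ℕ}
    (ha : a ∈ A) {x : ℝ × ℝ} (hx : x ∈ carpetF L A) : Psi L a x ∈ carpetF L A := by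
  rw [mem_carpetF] at hx ⊢
  intro n
  apply level_anti h
  obtain ⟨φ, hφ, z, hz, rfl⟩ := hx n
  exact ⟨_, isCell_succ.2 ⟨a, ha, φ, hφ, rfl⟩, z, hz, rfl⟩

lemma zero_mem_carpetF {L : ℕ} {A : Finset (ℕ × ℕ)} (h : GoodCarpet L A) :
    ((0, 0) : ℝ × ℝ) ∈ carpetF L A := by
  rw [mem_carpetF]
  intro n
  have hL := h.three_le
  have h0 : (0, 0) ∈ A := h.flat_border 0 0 (by omega) (by omega) (by simp)
  have : ∃ φ, IsCell L A n φ ∧ φ (0, 0) = (0, 0) := by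
    induction n with
    | zero => exact ⟨id, isCell_zero.2 rfl, rfl⟩
    | succ n ih =>
      obtain ⟨φ, hφ, h1⟩ := ih
      refine ⟨_, isCell_succ.2 ⟨_, h0, φ, hφ, rfl⟩, ?_⟩
      simp [h1, Psi]
  obtain ⟨φ, hφ, h1⟩ := this
  exact ⟨φ, hφ, (0, 0), mem_Q.2 (by simp), h1⟩

lemma cell_mem_carpetF {L : ℕ} {A : Finset (ℕ × ℕ)} (h : GoodCarpet L A) {n : ℕ}
    {φ : ℝ × ℝ → ℝ × ℝ} (hφ : IsCell L A n φ) : φ (0, 0) ∈ carpetF L A := by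
  induction n generalizing φ with
  | zero =>
    rw [isCell_zero] at hφ
    subst hφ
    exact zero_mem_carpetF h
  | succ n ih =>
    obtain ⟨a, ha, ψ, hψ, rfl⟩ := isCell_succ.1 hφ
    exact Psi_mem_carpetF h ha (ih hψ)

lemma cell_mem_Q {L : ℕ} {A : Finset (ℕ × ℕ)} (h : GoodCarpet L A) {n : ℕ}
    {φ : ℝ × ℝ → ℝ × ℝ} (hφ : IsCell L A n φ) {z : ℝ × ℝ} (hz : z ∈ Q) : φ z ∈ Q := by
  induction n generalizing φ with
  | zero =>
    rw [isCell_zero] at hφ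
    subst hφ
    exact hz
  | succ n ih =>
    obtain ⟨a, ha, ψ, hψ, rfl⟩ := isCell_succ.1 hφ
    exact Psi_mem_Q h ha (ih hψ)

lemma cell_dist {L : ℕ} {A : Finset (ℕ × ℕ)} (hL : 3 ≤ L) {n : ℕ}
    {φ : ℝ × ℝ → ℝ × ℝ} (hφ : IsCell L A n φ) {z : ℝ × ℝ} (hz : z ∈ Q) :
    dist (φ (0, 0)) (φ z) ≤ ((L : ℝ)⁻¹) ^ n := by
  obtain ⟨i, j, hij⟩ := isCell_form hL hφ
  have hP : (0 : ℝ) < (L : ℝ) ^ n := by positivity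
  obtain ⟨b1, b2, b3, b4⟩ := mem_Q.1 hz
  rw [hij, hij, Prod.dist_eq, inv_pow, ← one_div]
  simp only [Real.dist_eq, ← sub_div, abs_div, abs_of_pos hP]
  apply max_le
  · apply div_le_div_of_nonneg_right _ hP.le
    rw [abs_le]; constructor <;> linarith
  · apply div_le_div_of_nonneg_right _ hP.le
    rw [abs_le]; constructor <;> linarith

/-- Main chaining estimate at scale `L^{-m}`. -/
lemma scale_bound {L : ℕ} {A : Finset (ℕ × ℕ)} (h : GoodCarpet L A) {K : ℝ} (hK : 0 ≤ K)
    (HK : ∀ u ∈ VN L A 1, ∀ v ∈ VN L A 1, ∀ (g : ℝ × ℝ → ℝ) (δ : ℝ), 0 ≤ δ →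
      (∀ x y, Adj L A 1 x y → |g x - g y| ≤ δ) → |g u - g v| ≤ K * δ)
    {r : ℝ} (hr0 : 0 ≤ r) (hr1 : r < 1) {f : ℝ × ℝ → ℝ} (hf : ContinuousOn f (carpetF L A))
    {B : ℝ} (hB : 0 ≤ B) (hadj : ∀ k x y, Adj L A k x y → |f x - f y| ≤ B * r ^ k)
    {x y : ℝ × ℝ} (hx : x ∈ carpetF L A) (hy : y ∈ carpetF L A) {m : ℕ}
    (hclose : m = 0 ∨ (|x.1 - y.1| * (L : ℝ) ^ m < 1 ∧ |x.2 - y.2| * (L : ℝ) ^ m < 1)) :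
    |f x - f y| ≤ 2 * (K * (B * r ^ m * r) / (1 - r)) := by
  have hL := h.three_le
  have hL3 : (3 : ℝ) ≤ L := by exact_mod_cast hL
  have hcell : ∀ x ∈ carpetF L A, ∀ n, ∃ ψ χ, IsCell L A m ψ ∧ IsCell L A n χ ∧
      ∃ z ∈ Q, ψ (χ z) = x := by
    intro x hx n
    obtain ⟨φ, hφ, z, hz, hzx⟩ := mem_carpetF.1 hx (m + n)
    obtain ⟨ψ, χ, hψ, hχ, rfl⟩ := isCell_split hφ
    exact ⟨ψ, χ, hψ, hχ, z, hz, hzx⟩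
  have hjoin : ∀ {ψ χ : ℝ × ℝ → ℝ × ℝ} {n : ℕ}, IsCell L A m ψ → IsCell L A n χ →
      IsCell L A (m + n) (ψ ∘ χ) := by
    intro ψ χ n hψ hχ
    clear hclose hcell
    induction m generalizing ψ with
    | zero =>
      rw [isCell_zero] at hψ
      subst hψ
      simpa using hχ
    | succ m ih =>
      obtain ⟨a, ha, ξ, hξ, rfl⟩ := isCell_succ.1 hψ
      rw [show m + 1 + n = (m + n) + 1 by ring]
      exact isCell_succ.2 ⟨a, ha, _, ih hξ, rfl⟩
  choose ψ χ hψ hχ z hz hzx using hcell x hx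
  choose ψ' χ' hψ' hχ' z' hz' hzy using hcell y hy
  have hlim : ∀ (x : ℝ × ℝ) (_ : x ∈ carpetF L A) (ψ χ : ℕ → ℝ × ℝ → ℝ × ℝ)
      (_ : ∀ n, IsCell L A m (ψ n)) (_ : ∀ n, IsCell L A n (χ n)) (z : ℕ → ℝ × ℝ)
      (_ : ∀ n, z n ∈ Q) (_ : ∀ n, ψ n (χ n (z n)) = x),
      Filter.Tendsto (fun n => f (ψ n (χ n (0, 0)))) Filter.atTop (nhds (f x)) := by
    intro x hx ψ χ hψ hχ z hz hzx
    have h1 : Filter.Tendsto (fun n => ψ n (χ n (0, 0))) Filter.atTop (nhds x) := by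
      rw [tendsto_iff_dist_tendsto_zero]
      have hgeo : Filter.Tendsto (fun n => ((L : ℝ)⁻¹) ^ (n + m)) Filter.atTop (nhds 0) := by
        have := tendsto_pow_atTop_nhds_zero_of_lt_one (r := (L : ℝ)⁻¹) (by positivity)
          (inv_lt_one_of_one_lt₀ (by linarith))
        exact this.comp (Filter.tendsto_add_atTop_nat m)
      refine squeeze_zero (fun _ => dist_nonneg) (fun n => ?_) hgeo
      have := cell_dist hL (hjoin (hψ n) (hχ n)) (hz n)
      simp only [Function.comp, hzx] at this
      rwa [add_comm m n] at this
    have h2 : Filter.Tendsto (fun n => ψ n (χ n (0, 0))) Filter.atTop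
        (nhdsWithin x (carpetF L A)) := by
      rw [tendsto_nhdsWithin_iff]
      exact ⟨h1, Filter.Eventually.of_forall fun n => cell_mem_carpetF h (hjoin (hψ n) (hχ n))⟩
    exact (hf x hx).tendsto.comp h2
  have hlx := hlim x hx ψ χ hψ hχ z hz hzx
  have hly := hlim y hy ψ' χ' hψ' hχ' z' hz' hzy
  have hlxy := (hlx.sub hly).abs
  refine le_of_tendsto hlxy (Filter.Eventually.of_forall fun n => ?_)
  have hchain : ∀ {ψ χ : ℝ × ℝ → ℝ × ℝ}, IsCell L A m ψ → IsCell L A n χ → ∀ q ∈ V0,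
      |f (ψ (χ (0, 0))) - f (ψ q)| ≤ K * (B * r ^ m * r) / (1 - r) := by
    intro ψ χ hψ hχ q hq
    refine chain_bound h hK HK hr0 hr1 hχ (g := f ∘ ψ) (B := B * r ^ m) (by positivity) ?_
      (by simp [V0]) hq
    intro k x y hxy
    have := hadj _ _ _ (adj_cell hψ hxy)
    rw [pow_add] at this
    simp only [Function.comp]
    linarith
  have hshare : ∃ p ∈ V0, ∃ q ∈ V0, ψ n p = ψ' n q := by
    rcases hclose with rfl | ⟨h1, h2⟩
    · have e1 := isCell_zero.1 (hψ n)
      have e2 := isCell_zero.1 (hψ' n)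
      rw [e1, e2]
      exact ⟨(0, 0), by simp [V0], (0, 0), by simp [V0], rfl⟩
    · refine share_corner hL (hψ n) (hψ' n) (cell_mem_Q h (hχ n) (hz n))
        (cell_mem_Q h (hχ' n) (hz' n)) ?_ ?_
      · rw [hzx, hzy]; exact h1
      · rw [hzx, hzy]; exact h2
  obtain ⟨p, hp, q, hq, hpq⟩ := hshare
  have b1 := hchain (hψ n) (hχ n) p hp
  have b2 := hchain (hψ' n) (hχ' n) q hq
  rw [← hpq, abs_sub_comm] at b2
  have b3 := abs_sub_le (f (ψ n (χ n (0, 0)))) (f (ψ n p)) (f (ψ' n (χ' n (0, 0))))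
  linarith

lemma abs_fst_le_eudist (x y : ℝ × ℝ) : |x.1 - y.1| ≤ eudist x y :=
  Real.abs_le_sqrt (by nlinarith [sq_nonneg (x.2 - y.2)])

lemma abs_snd_le_eudist (x y : ℝ × ℝ) : |x.2 - y.2| ≤ eudist x y :=
  Real.abs_le_sqrt (by nlinarith [sq_nonneg (x.1 - y.1)])


/-- Remark 4.4 (1), planar case: Hölder continuity of functions of
finite energy on the carpet `F`. -/
theorem holder_on_carpet (L : ℕ) (A : Finset (ℕ × ℕ)) (h : GoodCarpet L A) :
    ∃ c θ : ℝ, 1 ≤ c ∧ 0 < θ ∧ θ < 2 ∧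
      ∀ f : ℝ × ℝ → ℝ, ContinuousOn f (carpetF L A) →
        ∀ x ∈ carpetF L A, ∀ y ∈ carpetF L A,
          ∀ M : ℝ, (∀ n : ℕ, RR L A n * Dform L A n f ≤ M) →
            |f x - f y| ^ 2 ≤ c * eudist x y ^ θ * M := by
  have hL := h.three_le
  have hL3 : (3 : ℝ) ≤ L := by exact_mod_cast hL
  have hL0 : (0 : ℝ) < L := by linarith
  have hL1 : (1 : ℝ) < L := by linarith
  have hl1 := lam_gt_one hL
  have hl0 : 0 < lam L := by linarith
  obtain ⟨K, hK, HK⟩ := exists_K h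
  -- the contraction ratio and the exponent
  set r : ℝ := (Real.sqrt (lam L))⁻¹ with hr
  have hs1 : 1 < Real.sqrt (lam L) := by
    rw [Real.lt_sqrt zero_le_one]
    simpa using hl1
  have hr0 : 0 < r := by positivity
  have hr1 : r < 1 := inv_lt_one_of_one_lt₀ hs1
  have hr2 : r ^ 2 = (lam L)⁻¹ := by rw [hr, inv_pow, Real.sq_sqrt hl0.le]
  set θ : ℝ := Real.log (lam L) / Real.log L with hθ
  have hlogL : 0 < Real.log L := Real.log_pos hL1
  have hloglam : 0 < Real.log (lam L) := Real.log_pos hl1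
  have hθ0 : 0 < θ := by positivity
  have hθ1 : θ < 1 := by
    rw [hθ, div_lt_one hlogL]
    exact Real.log_lt_log hl0 (lam_lt hL)
  have hLθ : (L : ℝ) ^ θ = lam L := by
    rw [Real.rpow_def_of_pos hL0, hθ, mul_div_cancel₀ _ hlogL.ne', Real.exp_log hl0]
  set C : ℝ := 2 * (K * r / (1 - r)) with hC
  have hr' : 0 < 1 - r := by linarith
  have hC0 : 0 ≤ C := by positivity
  refine ⟨1 + C ^ 2 * 2 * lam L, θ, ?_, hθ0, by linarith, ?_⟩
  · have : 0 ≤ C ^ 2 * 2 * lam L := by positivity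
    linarith
  intro f hf x hx y hy M hM
  have hM0 : 0 ≤ M :=
    (mul_nonneg (RR_pos h 0).le (Dform_nonneg L A 0 f)).trans (hM 0)
  set d := eudist x y with hd
  have hd0 : 0 ≤ d := Real.sqrt_nonneg _
  set B : ℝ := Real.sqrt (2 * M) with hB
  have hB0 : 0 ≤ B := Real.sqrt_nonneg _
  have hB2 : B ^ 2 = 2 * M := Real.sq_sqrt (by positivity)
  have hadj : ∀ k x y, Adj L A k x y → |f x - f y| ≤ B * r ^ k := by
    intro k x y hxy
    have h1 := adj_diff_decay h hM k hxy
    apply abs_le_of_sq_le_sq _ (by positivity)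
    rw [mul_pow, hB2, ← pow_mul, mul_comm k 2, pow_mul, hr2, inv_pow, ← div_eq_mul_inv,
      le_div_iff₀ (by positivity)]
    linarith
  -- the estimate at scale m
  have hscale : ∀ m : ℕ, (m = 0 ∨ (|x.1 - y.1| * (L : ℝ) ^ m < 1 ∧
      |x.2 - y.2| * (L : ℝ) ^ m < 1)) →
      |f x - f y| ^ 2 ≤ C ^ 2 * 2 * M * ((lam L)⁻¹) ^ m := by
    intro m hm
    have h1 := scale_bound h hK HK hr0.le hr1 hf hB0 hadj hx hy hm
    have h2 : 2 * (K * (B * r ^ m * r) / (1 - r)) = C * (B * r ^ m) := by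
      rw [hC]; ring
    rw [h2] at h1
    calc |f x - f y| ^ 2 ≤ (C * (B * r ^ m)) ^ 2 := pow_le_pow_left₀ (abs_nonneg _) h1 2
      _ = C ^ 2 * B ^ 2 * (r ^ 2) ^ m := by ring
      _ = _ := by rw [hB2, hr2]; ring
  have hfin : ∀ m : ℕ, ((lam L)⁻¹) ^ m ≤ lam L * d ^ θ →
      (m = 0 ∨ (|x.1 - y.1| * (L : ℝ) ^ m < 1 ∧ |x.2 - y.2| * (L : ℝ) ^ m < 1)) →
      |f x - f y| ^ 2 ≤ (1 + C ^ 2 * 2 * lam L) * d ^ θ * M := by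
    intro m hm hm'
    have hdθ : 0 ≤ d ^ θ := Real.rpow_nonneg hd0 _
    calc |f x - f y| ^ 2 ≤ C ^ 2 * 2 * M * ((lam L)⁻¹) ^ m := hscale m hm'
      _ ≤ C ^ 2 * 2 * M * (lam L * d ^ θ) := by gcongr
      _ = C ^ 2 * 2 * lam L * d ^ θ * M := by ring
      _ ≤ (1 + C ^ 2 * 2 * lam L) * d ^ θ * M := by
        have : 0 ≤ d ^ θ * M := by positivity
        linarith
  by_cases hxy : d = 0
  · have h1 : x.1 = y.1 := by
      have := abs_fst_le_eudist x y
      rw [← hd, hxy] at this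
      have := abs_nonpos_iff.1 this
      linarith
    have h2 : x.2 = y.2 := by
      have := abs_snd_le_eudist x y
      rw [← hd, hxy] at this
      have := abs_nonpos_iff.1 this
      linarith
    have : x = y := Prod.ext h1 h2
    rw [this, hxy, Real.zero_rpow hθ0.ne']
    simp
  have hdpos : 0 < d := lt_of_le_of_ne hd0 (Ne.symm hxy)
  by_cases hd1 : 1 ≤ d
  · refine hfin 0 ?_ (Or.inl rfl)
    have : 1 ≤ d ^ θ := Real.one_le_rpow hd1 hθ0.le
    simp only [pow_zero]
    nlinarith
  · push Not at hd1
    have hex : ∃ m : ℕ, 1 ≤ d * (L : ℝ) ^ (m + 1) := by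
      obtain ⟨k, hk⟩ := pow_unbounded_of_one_lt (d⁻¹) hL1
      refine ⟨k, ?_⟩
      have h1 : (L : ℝ) ^ k ≤ (L : ℝ) ^ (k + 1) := pow_le_pow_right₀ hL1.le (Nat.le_succ k)
      rw [← inv_le_iff_one_le_mul₀' hdpos]
      linarith
    set m := Nat.find hex with hmdef
    have hm1 : 1 ≤ d * (L : ℝ) ^ (m + 1) := Nat.find_spec hex
    have hm2 : d * (L : ℝ) ^ m < 1 := by
      rcases Nat.eq_zero_or_pos m with h0 | h0
      · rw [h0]; simpa using hd1
      · have := Nat.find_min hex (m := m - 1) (by omega)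
        rw [Nat.sub_add_cancel h0] at this
        exact not_le.1 this
    have hP : (0 : ℝ) ≤ (L : ℝ) ^ m := by positivity
    refine hfin m ?_ (Or.inr ⟨?_, ?_⟩)
    · have h1 : 1 ≤ (d * (L : ℝ) ^ (m + 1)) ^ θ := Real.one_le_rpow hm1 hθ0.le
      rw [Real.mul_rpow hd0 (by positivity), ← Real.rpow_natCast, ← Real.rpow_mul hL0.le,
        mul_comm ((m + 1 : ℕ) : ℝ) θ, Real.rpow_mul hL0.le, hLθ, Real.rpow_natCast, pow_succ] at h1
      rw [inv_pow, inv_le_iff_one_le_mul₀ (by positivity)]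
      calc (1 : ℝ) ≤ _ := h1
        _ = _ := by ring
    · exact (mul_le_mul_of_nonneg_right (abs_fst_le_eudist x y) hP).trans_lt hm2
    · exact (mul_le_mul_of_nonneg_right (abs_snd_le_eudist x y) hP).trans_lt hm2

end Carpet
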